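/- From the position P6, placing a chap at h9 is Alfred's unique non-losing move: after Alfred places a chap at h9, Betty has no winning strategy from the resulting position, while after every other legal move of Alfred from P6, Betty has a winning strategy from the resulting position. -/

import Mathlib

/-!
Formalization of Philosophers' Phutball on an `m × n` board (`m` rows, `n` columns).
Points are pairs `(column, row)` of integers, with columns `1, …, n` (a, b, c, …)
and rows `1, …, m` (bottom to top).  Player `true` is Alfred (first player, aims
for the top row `m`); player `false` is Betty (aims for the bottom row `1`).
-/

/-- A player: `true` is Alfred, `false` is Betty. -/
abbrev Player := Bool

/-- A Phutball position: the ball's point `(column, row)`, the finite set of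
chaps, and the player whose turn it is. -/
structure PState where
  ball : ℤ × ℤ
  chaps : Finset (ℤ × ℤ)
  turn : Player
deriving DecidableEq

/-- The eight horizontal, vertical and diagonal directions. -/
def dirs : Finset (ℤ × ℤ) :=
  {(1, 0), (1, 1), (0, 1), (-1, 1), (-1, 0), (-1, -1), (0, -1), (1, -1)}

/-- The point reached from `b` after `i` steps in direction `d`. -/
def ray (b d : ℤ × ℤ) (i : ℤ) : ℤ × ℤ := (b.1 + i * d.1, b.2 + i * d.2)

/-- A point is on the `m × n` board. -/
def OnBoard (m n : ℤ) (p : ℤ × ℤ) : Prop :=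
  1 ≤ p.1 ∧ p.1 ≤ n ∧ 1 ≤ p.2 ∧ p.2 ≤ m

/-- A single hop on a board with `n` columns: the ball at `b` moves in one of the
eight directions `d` over a contiguous nonempty line of `k` chaps, landing on the
first point beyond them that carries no chap; the jumped-over chaps are removed.
The landing point must not lie onto or past the sidelines (outside columns
`1, …, n`), but it may lie past the top or bottom row. -/
def Hop (n : ℤ) (b : ℤ × ℤ) (c : Finset (ℤ × ℤ)) (b' : ℤ × ℤ) (c' : Finset (ℤ × ℤ)) : Prop :=
  ∃ d ∈ dirs, ∃ k : ℕ, 1 ≤ k ∧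
    (∀ i : ℕ, 1 ≤ i → i ≤ k → ray b d i ∈ c) ∧
    ray b d (k + 1) ∉ c ∧
    1 ≤ (ray b d (k + 1)).1 ∧ (ray b d (k + 1)).1 ≤ n ∧
    b' = ray b d (k + 1) ∧
    c' = c \ Finset.image (fun i : ℕ => ray b d i) (Finset.Icc 1 k)

/-- A jump is a nonempty sequence of hops (the player may stop after any hop,
and the removed chaps cannot be re-used by later hops of the same jump).  The
jump can continue after a hop only if the ball has not been carried past the top
or bottom row (which would end the game immediately). -/
inductive Jump (m n : ℤ) : ℤ × ℤ → Finset (ℤ × ℤ) → ℤ × ℤ → Finset (ℤ × ℤ) → Prop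
  | single {b c b' c'} : Hop n b c b' c' → Jump m n b c b' c'
  | cons {b c b₁ c₁ b' c'} : Hop n b c b₁ c₁ → 1 ≤ b₁.2 → b₁.2 ≤ m →
      Jump m n b₁ c₁ b' c' → Jump m n b c b' c'

/-- The winner, if any, of a position (evaluated between turns): Alfred wins if
the ball rests on the top row `m` or has been carried past it; Betty wins if the
ball rests on the bottom row `1` or has been carried past it. -/
def winner (m : ℤ) (s : PState) : Option Player :=
  if m ≤ s.ball.2 then some true else if s.ball.2 ≤ 1 then some false else none

/-- A single legal move on the `m × n` board: the player to move either places a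
chap on a vacant on-board point, or moves the ball by a jump; the turn passes to
the other player. -/
def MoveRel (m n : ℤ) (s t : PState) : Prop :=
  t.turn = !s.turn ∧
    ((∃ p, OnBoard m n p ∧ p ∉ s.chaps ∧ p ≠ s.ball ∧
        t.ball = s.ball ∧ t.chaps = insert p s.chaps) ∨
      Jump m n s.ball s.chaps t.ball t.chaps)

/-- An infinite record of play: while the game is not over and a legal move
exists, a legal move is made; otherwise the position is frozen forever. -/
def IsPlay (m n : ℤ) (f : ℕ → PState) : Prop :=
  ∀ k,
    (winner m (f k) = none ∧ (∃ t, MoveRel m n (f k) t) ∧ MoveRel m n (f k) (f (k + 1))) ∨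
    ((winner m (f k) ≠ none ∨ ¬ ∃ t, MoveRel m n (f k) t) ∧ f (k + 1) = f k)

/-- A strategy for player `p` that always proposes a legal move whenever the game
is not over, it is `p`'s turn, and some legal move exists. -/
def LegalStrategy (m n : ℤ) (p : Player) (σ : PState → PState) : Prop :=
  ∀ s, s.turn = p → winner m s = none → (∃ t, MoveRel m n s t) → MoveRel m n s (σ s)

/-- The play `f` follows the strategy `σ` of player `p`. -/
def Follows (m n : ℤ) (p : Player) (σ : PState → PState) (f : ℕ → PState) : Prop :=
  ∀ k, (f k).turn = p → winner m (f k) = none → (∃ t, MoveRel m n (f k) t) →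
    f (k + 1) = σ (f k)

/-- Player `p` has a winning strategy from `s₀` on the `m × n` board: a legal
strategy guaranteeing that, against every play of the opponent, `p` wins after
finitely many moves. -/
def WinsFrom (m n : ℤ) (p : Player) (s₀ : PState) : Prop :=
  ∃ σ, LegalStrategy m n p σ ∧
    ∀ f, IsPlay m n f → f 0 = s₀ → Follows m n p σ f → ∃ k, winner m (f k) = some p

/-- Player `p` has a drawing strategy from `s₀` on the `m × n` board: a legal
strategy guaranteeing that the opponent never wins (play may continue forever). -/
def DrawsFrom (m n : ℤ) (p : Player) (s₀ : PState) : Prop :=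
  ∃ σ, LegalStrategy m n p σ ∧
    ∀ f, IsPlay m n f → f 0 = s₀ → Follows m n p σ f → ∀ k, winner m (f k) ≠ some (!p)

/-- A position is drawn if both players have drawing strategies from it. -/
def Drawn (m n : ℤ) (s : PState) : Prop :=
  DrawsFrom m n true s ∧ DrawsFrom m n false s

/-- The 24 chaps of the position `P0` on the 12 × 10 board:
c1, c2, c5, c7, c9, c10, c11, c12, d6, e4, e11, e12, f1, f2, f9, g7,
h1, h2, h3, h4, h6, h8, h11, h12. -/
def P0chaps : Finset (ℤ × ℤ) :=
  {(3, 1), (3, 2), (3, 5), (3, 7), (3, 9), (3, 10), (3, 11), (3, 12), (4, 6), (5, 4), (5, 11), (5, 12), (6, 1), (6, 2), (6, 9), (7, 7), (8, 1), (8, 2), (8, 3), (8, 4), (8, 6), (8, 8), (8, 11), (8, 12)}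

/-- The position `P0`: ball at a2 = (1, 2), the 24 chaps above, Alfred to move. -/
def P0 : PState := ⟨(1, 2), P0chaps, true⟩

/-- The position `P6`: `P0` with additional chaps at b3, c4, d5, e6, f7, g8, with Alfred to move. -/
def P6 : PState := ⟨(1, 2), P0chaps ∪ {(2, 3), (3, 4), (4, 5), (5, 6), (6, 7), (7, 8)}, true⟩

/-- The result of Alfred placing a chap at h9 = (8, 9) from `P6`. -/
def P6_h9 : PState := ⟨(1, 2), insert (8, 9) P6.chaps, false⟩

namespace Phutball

/-- Applies `f` to `n`, making the kernel evaluate `n` first. -/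
def eager {α : Type} (n : ℕ) (f : ℕ → α) : α :=
  match n with
  | 0 => f 0
  | k + 1 => f (k + 1)

/-- The square coded by `q = 64 + 16 * row + column`. -/
def pt (q : ℕ) : ℤ × ℤ := ((q % 16 : ℕ), (q / 16 : ℕ) - 4)

/-- Whether the square coded by `q` carries a chap in the bit mask `m`. -/
def occ (m q : ℕ) : Bool := Nat.beq (Nat.land (Nat.shiftRight m q) 1) 1

/-- Adds or removes the chap on `q`. The square `q` is represented by bit `q ≥ 64`; the bits below
`64` are irrelevant, but make distinct masks hash differently in the kernel. -/
def toggle (m q : ℕ) : ℕ :=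
  Nat.xor (Nat.xor m (Nat.shiftLeft 1 q)) (Nat.shiftLeft 1 (Nat.mod q 61))

/-- The codes `16 * (dy + 1) + (dx + 1)` of the eight directions `(dx, dy)`. -/
def codes : List ℕ := [18, 34, 33, 32, 16, 0, 1, 2]

/-- The neighbour of `q` in the direction coded by `e`. -/
def step (e q : ℕ) : ℕ := Nat.sub (Nat.add q e) 17

/-- The column of `q` lies between the sidelines. -/
def inCols (q : ℕ) : Bool := Nat.ble 1 (Nat.mod q 16) && Nat.ble (Nat.mod q 16) 10

/-- The row of `q` lies on the board. -/
def inRows (q : ℕ) : Bool := Nat.ble 5 (Nat.div q 16) && Nat.ble (Nat.div q 16) 16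

/-- Player `a` has won once the ball rests on (or beyond) `q`. -/
def won (a : Player) (q : ℕ) : Bool :=
  match a with
  | true => Nat.ble 16 (Nat.div q 16)
  | false => Nat.ble (Nat.div q 16) 5

/-- Removes the line of at most `f` chaps starting at `q` in the direction coded by `e`; returns
the first square beyond it and the remaining chaps. -/
def walk (e : ℕ) : ℕ → ℕ → ℕ → ℕ × ℕ
  | 0, q, m => (q, m)
  | f + 1, q, m =>
    bif occ m q then
      eager (step e q) fun q' => eager (toggle m q) fun m' => walk e f q' m'
    else (q, m)

/-- The result of the hop of the ball from `q` in the direction coded by `e`, if it is legal. -/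
def hop (e q m : ℕ) : Option (ℕ × ℕ) :=
  eager (step e q) fun q₁ =>
    bif occ m q₁ then
      match walk e 13 q₁ m with
      | (q', m') => bif inCols q' then some (q', m') else none
    else none

/-- Searches for a winning jump of player `a` with at most `f` hops and returns its landing
squares. -/
def threat (a : Player) : ℕ → ℕ → ℕ → Option (List ℕ)
  | 0, _, _ => none
  | f + 1, q, m => codes.findSome? fun e =>
    match hop e q m with
    | none => none
    | some (q', m') =>
      bif won a q' then some [q']
      else bif inRows q' then (threat a f q' m').map (q' :: ·) else none

/-- `P` holds after every jump, and no jump has more than `f` hops. -/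
def allJumps (P : ℕ → ℕ → Bool) : ℕ → ℕ → ℕ → Bool
  | 0, _, _ => false
  | f + 1, q, m => codes.all fun e =>
    match hop e q m with
    | none => true
    | some (q₁, m₁) => P q₁ m₁ && (!inRows q₁ || allJumps P f q₁ m₁)

/-- The squares of the board. -/
def squares : List ℕ :=
  (List.range 12).flatMap fun r => (List.range 10).map fun c => 16 * (r + 5) + (c + 1)

/-- The chap placed on `x` is a legal move. -/
def vacant (q m x : ℕ) : Bool := inCols x && inRows x && !occ m x && !Nat.beq x q

/-- `P` holds after placing a chap on any vacant square of `l`. -/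
def allPlacements (P : ℕ → ℕ → Bool) (l : List ℕ) (q m : ℕ) : Bool :=
  l.all fun x => !vacant q m x || eager (toggle m x) (P x)

/-- The opponent of `a` has to move, and `next` holds after each move that neither wins for `a`
nor leaves a winning jump of `a` intact. -/
def defends (a : Player) (next : ℕ → ℕ → Bool) (q m : ℕ) : Bool :=
  squares.any (vacant q m) &&
  allJumps (fun q' m' => won a q' || (!won (!a) q' && next q' m')) 30 q m &&
  allPlacements (fun _ => next q) ((threat a 30 q m).getD squares) q m

/-- Player `a`, to move, wins by a jump, or by placing chaps on squares that are picked from the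
successive lists of candidates. -/
def attacks (a : Player) : List (List ℕ) → ℕ → ℕ → Bool
  | [], q, m => (threat a 30 q m).isSome
  | h :: hs, q, m => (threat a 30 q m).isSome ||
    h.any fun x => vacant q m x &&
      eager (toggle m x) fun m₁ => defends a (attacks a hs) q m₁

/-- Every move of the opponent of `a` wins for `a` by means of the given candidates, except for the
move to `(q₀, m₀)`. -/
def allLose (a : Player) (hints : ℕ → List (List ℕ)) (q₀ m₀ q m : ℕ) : Bool :=
  allJumps (fun q' m' => (Nat.beq q' q₀ && Nat.beq m' m₀) ||
    won a q' || (!won (!a) q' && attacks a (hints 0) q' m')) 30 q m &&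
  allPlacements (fun x m' => (Nat.beq q q₀ && Nat.beq m' m₀) || attacks a (hints x) q m')
    squares q m

/-- The mask of the chaps of `P0`. -/
def mask₀ : ℕ :=
  34274981401192477441164756189566551798045271445175763066677466088739336485863424

/-- The ball of the `i`-th position of the drawing cycle (`i < 18`): these positions are `P0` with
`i` further chaps on the main diagonal (`i ≤ 8`), and then the same positions rotated by a
half-turn. -/
def cycleBall (i : ℕ) : ℕ := bif Nat.ble i 8 then 97 else 250

/-- The chaps of the `i`-th position of the drawing cycle. -/
def cycleMask (i : ℕ) : ℕ :=
  bif Nat.ble i 8 then (List.range i).foldl (fun m j => toggle m (114 + 17 * j)) mask₀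
  else (List.range (i - 9)).foldl (fun m j => toggle m (233 - 17 * j)) mask₀

/-- Candidate placements against the moves that leave the `i`-th position of the cycle; `x` is the
square of a placed chap. -/
def cycleHints (i x : ℕ) : List (List ℕ) :=
  match i with
  | 1 | 15 => [[164]]
  | 3 | 13 => [[147]]
  | 5 | 11 => [[217, 182, 184], [168, 217]]
  | 6 => [[183]]
  | 9 => [[265], [265, 234, 251, 231]]
  | 17 =>
    bif Nat.beq x 218 then
      [[265], [114], [164, 148], [147, 182], [217, 182, 184, 216], [168, 217]]
    else bif Nat.beq x 97 then [[265]] else [[97], [265]]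
  | _ => []


lemma eager_eq {α : Type} (n : ℕ) (f : ℕ → α) : eager n f = f n := by
  cases n <;> rfl

lemma occ_eq_testBit (m q : ℕ) : occ m q = m.testBit q := by
  have h : occ m q = Nat.beq ((m >>> q) &&& 1) 1 := rfl
  rw [h, Nat.testBit, Nat.and_comm 1, Nat.and_one_is_mod]
  rcases Nat.mod_two_eq_zero_or_one (m >>> q) with h | h <;> rw [h] <;> rfl

/-- The direction with code `e`. -/
def dir (e : ℕ) : ℤ × ℤ := ((e % 16 : ℕ) - 1, (e / 16 : ℕ) - 1)

lemma mem_dirs {d : ℤ × ℤ} : d ∈ dirs ↔ ∃ e ∈ codes, dir e = d := by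
  rw [show dirs = codes.toFinset.image dir by decide]
  simp

lemma codes_bounds {e : ℕ} (he : e ∈ codes) : e % 16 ≤ 2 ∧ e / 16 ≤ 2 ∧ e ≠ 17 := by
  revert e; decide

lemma dir_bounds {e : ℕ} (he : e ∈ codes) :
    -1 ≤ (dir e).1 ∧ (dir e).1 ≤ 1 ∧ -1 ≤ (dir e).2 ∧ (dir e).2 ≤ 1 ∧
      ((dir e).1 ≠ 0 ∨ (dir e).2 ≠ 0) := by
  revert e; decide

lemma pt_injective {q q' : ℕ} (h : pt q = pt q') : q = q' := by
  simp only [pt, Prod.mk.injEq] at h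
  omega

lemma exists_pt {p : ℤ × ℤ} (hp : OnBoard 12 10 p) : ∃ q ∈ squares, pt q = p := by
  obtain ⟨x, y⟩ := p
  simp only [OnBoard] at hp
  refine ⟨16 * ((y - 1).toNat + 5) + ((x - 1).toNat + 1), ?_, ?_⟩
  · simp only [squares, List.mem_flatMap, List.mem_map, List.mem_range]
    exact ⟨_, by omega, _, by omega, rfl⟩
  · simp only [pt, Prod.mk.injEq]
    omega

lemma inCols_iff {q : ℕ} : inCols q = true ↔ 1 ≤ (pt q).1 ∧ (pt q).1 ≤ 10 := by
  have h : inCols q = (Nat.ble 1 (q % 16) && Nat.ble (q % 16) 10) := rfl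
  simp only [h, pt, Bool.and_eq_true, Nat.ble_eq]
  omega

lemma inRows_iff {q : ℕ} : inRows q = true ↔ 1 ≤ (pt q).2 ∧ (pt q).2 ≤ 12 := by
  have h : inRows q = (Nat.ble 5 (q / 16) && Nat.ble (q / 16) 16) := rfl
  simp only [h, pt, Bool.and_eq_true, Nat.ble_eq]
  omega

lemma onBoard_pt {q : ℕ} (h : OnBoard 12 10 (pt q)) : 64 ≤ q := by
  simp only [OnBoard, pt] at h
  omega

lemma winner_eq_some_iff {s : PState} {q : ℕ} (hs : s.ball = pt q) (a : Player) :
    winner 12 s = some a ↔ won a q = true := by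
  have h₁ : won true q = Nat.ble 16 (q / 16) := rfl
  have h₂ : won false q = Nat.ble (q / 16) 5 := rfl
  simp only [winner, hs, pt]
  cases a <;> simp only [h₁, h₂, Nat.ble_eq] <;> split_ifs <;> simp <;> omega

lemma winner_eq_none {s : PState} {q : ℕ} (hs : s.ball = pt q) (a : Player)
    (h₁ : won a q = false) (h₂ : won (!a) q = false) : winner 12 s = none := by
  rw [Option.eq_none_iff_forall_ne_some]
  intro b hb
  rw [winner_eq_some_iff hs] at hb
  cases a <;> cases b <;> simp_all

/-- The mask `m` describes the set `c` of chaps. -/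
structure Rep (m : ℕ) (c : Finset (ℤ × ℤ)) : Prop where
  onBoard : ∀ p ∈ c, OnBoard 12 10 p
  occ_iff : ∀ q, 64 ≤ q → (occ m q = true ↔ pt q ∈ c)

namespace Rep

variable {m q : ℕ} {c c' : Finset (ℤ × ℤ)}

lemma unique (h : Rep m c) (h' : Rep m c') : c = c' := by
  ext p
  constructor <;> intro hp
  · obtain ⟨q, -, rfl⟩ := exists_pt (h.onBoard p hp)
    have hq := onBoard_pt (h.onBoard _ hp)
    exact (h'.occ_iff q hq).1 ((h.occ_iff q hq).2 hp)
  · obtain ⟨q, -, rfl⟩ := exists_pt (h'.onBoard p hp)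
    have hq := onBoard_pt (h'.onBoard _ hp)
    exact (h.occ_iff q hq).1 ((h'.occ_iff q hq).2 hp)

lemma occ_toggle {r : ℕ} (hr : 64 ≤ r) :
    occ (toggle m q) r = (occ m r ^^ decide (q = r)) := by
  have h : toggle m q = (m ^^^ (1 <<< q)) ^^^ (1 <<< (q % 61)) := rfl
  have h' : q % 61 ≠ r := by omega
  simp [occ_eq_testBit, h, Nat.testBit_xor, Nat.one_shiftLeft, Nat.testBit_two_pow, h']

lemma erase (h : Rep m c) (hq : pt q ∈ c) : Rep (toggle m q) (c.erase (pt q)) := by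
  refine ⟨fun p hp ↦ h.onBoard p (Finset.mem_of_mem_erase hp), fun r hr ↦ ?_⟩
  have h₁ := h.occ_iff r hr
  rw [occ_toggle hr, Finset.mem_erase]
  by_cases hqr : q = r
  · subst hqr
    simp [h₁.2 hq]
  · have : pt r ≠ pt q := fun h ↦ hqr (pt_injective h).symm
    simp [hqr, this, h₁]

lemma insert (h : Rep m c) (hq : pt q ∉ c) (hb : OnBoard 12 10 (pt q)) :
    Rep (toggle m q) (insert (pt q) c) := by
  refine ⟨fun p hp ↦ ?_, fun r hr ↦ ?_⟩
  · rcases Finset.mem_insert.1 hp with rfl | hp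
    exacts [hb, h.onBoard p hp]
  · have h₁ := h.occ_iff r hr
    rw [occ_toggle hr, Finset.mem_insert]
    by_cases hqr : q = r
    · subst hqr
      have : occ m q = false := by simpa [hq] using h₁
      simp [this]
    · have : pt r ≠ pt q := fun h ↦ hqr (pt_injective h).symm
      simp [hqr, this, h₁]

end Rep

lemma pt_step {e q : ℕ} (he : e ∈ codes) (hq : OnBoard 12 10 (pt q)) :
    pt (step e q) = ray (pt q) (dir e) 1 ∧ 64 ≤ step e q := by
  have h : step e q = q + e - 17 := rfl
  have := codes_bounds he
  simp only [OnBoard, pt, ray, dir, h, Prod.mk.injEq] at *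
  omega

lemma ray_ray (b d : ℤ × ℤ) (i j : ℤ) : ray (ray b d i) d j = ray b d (i + j) := by
  simp only [ray, Prod.mk.injEq]
  constructor <;> ring

lemma ray_zero (b d : ℤ × ℤ) : ray b d 0 = b := by simp [ray]

lemma ray_injective {e : ℕ} (he : e ∈ codes) {b : ℤ × ℤ} {i j : ℤ}
    (h : ray b (dir e) i = ray b (dir e) j) : i = j := by
  simp only [ray, Prod.mk.injEq, add_right_inj] at h
  rcases (dir_bounds he).2.2.2.2 with hd | hd
  · exact mul_right_cancel₀ hd h.1
  · exact mul_right_cancel₀ hd h.2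

lemma walk_spec {e : ℕ} (he : e ∈ codes) (f : ℕ) {q m : ℕ} {c : Finset (ℤ × ℤ)} (h : Rep m c)
    (hq : 64 ≤ q) {q' m' : ℕ} (hw : walk e f q m = (q', m')) :
    ∃ k ≤ f, pt q' = ray (pt q) (dir e) k ∧ (∀ i : ℕ, i < k → ray (pt q) (dir e) i ∈ c) ∧
      (k < f → pt q' ∉ c) ∧ 64 ≤ q' ∧
      Rep m' (c \ (Finset.range k).image fun i : ℕ ↦ ray (pt q) (dir e) i) := by
  induction f generalizing q m c with
  | zero =>
    obtain ⟨rfl, rfl⟩ := Prod.mk.inj hw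
    exact ⟨0, le_rfl, by simp [ray_zero], by simp, by simp, hq, by simpa using h⟩
  | succ f ih =>
    have h₀ := h.occ_iff q hq
    cases ho : occ m q
    · simp only [walk, ho, cond_false] at hw
      obtain ⟨rfl, rfl⟩ := Prod.mk.inj hw
      exact ⟨0, by simp, by simp [ray_zero], by simp, by simpa [ho] using h₀, hq, by simpa using h⟩
    · simp only [walk, ho, cond_true, eager_eq] at hw
      have hqc := h₀.1 ho
      obtain ⟨h₁, h₂⟩ := pt_step he (h.onBoard _ hqc)
      obtain ⟨k, hk, hq', hc, hn, h64, hr⟩ := ih (h.erase hqc) h₂ hw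
      have hray (i : ℕ) : ray (pt (step e q)) (dir e) i = ray (pt q) (dir e) ((i + 1 : ℕ) : ℤ) := by
        rw [h₁, ray_ray, add_comm, Nat.cast_add, Nat.cast_one]
      simp only [hray] at hq' hc hr
      refine ⟨k + 1, by omega, hq', fun i hi ↦ ?_, fun hk' hq'' ↦ ?_, h64, ?_⟩
      · cases i with
        | zero => simpa [ray_zero] using hqc
        | succ i => exact Finset.mem_of_mem_erase (hc i (by omega))
      · refine hn (by omega) (Finset.mem_erase.2 ⟨fun hqq ↦ ?_, hq''⟩)
        rw [hq'] at hqq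
        nth_rewrite 2 [← ray_zero (pt q) (dir e)] at hqq
        have := ray_injective he hqq
        omega
      · convert hr using 1
        ext p
        simp only [Finset.mem_sdiff, Finset.mem_image, Finset.mem_range, Finset.mem_erase]
        constructor
        · rintro ⟨hp, hpi⟩
          exact ⟨⟨fun hpq ↦ hpi ⟨0, by omega, by simp [ray_zero, hpq]⟩, hp⟩,
            fun ⟨i, hi, hpi'⟩ ↦ hpi ⟨i + 1, by omega, hpi'⟩⟩
        · rintro ⟨⟨hpq, hp⟩, hpi⟩
          refine ⟨hp, fun ⟨i, hi, hpi'⟩ ↦ ?_⟩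
          cases i with
          | zero => exact hpq (by simpa [ray_zero] using hpi'.symm)
          | succ i => exact hpi ⟨i, by omega, hpi'⟩

/-- A line of chaps on the board is shorter than the fuel of `walk`. -/
lemma line_short {e : ℕ} (he : e ∈ codes) {c : Finset (ℤ × ℤ)} (hc : ∀ p ∈ c, OnBoard 12 10 p)
    {b : ℤ × ℤ} {k : ℕ} (h : ∀ i : ℕ, i < k → ray b (dir e) i ∈ c) : k < 13 := by
  by_contra! hk
  have h₀ := hc _ (h 0 (by omega))
  have h₁ := hc _ (h 12 (by omega))
  have hd := dir_bounds he
  simp only [OnBoard, ray] at h₀ h₁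
  push_cast at h₀ h₁
  omega

/-- The data of a hop from `b` in the direction `d` over `k` chaps. -/
structure Line (b d : ℤ × ℤ) (c : Finset (ℤ × ℤ)) (k : ℕ) : Prop where
  pos : 1 ≤ k
  mem : ∀ i : ℕ, 1 ≤ i → i ≤ k → ray b d i ∈ c
  notMem : ray b d (k + 1) ∉ c

lemma Line.unique {b d : ℤ × ℤ} {c : Finset (ℤ × ℤ)} {k l : ℕ} (h : Line b d c k)
    (h' : Line b d c l) : k = l := by
  rcases lt_trichotomy k l with hkl | hkl | hkl
  · exact absurd (by exact_mod_cast h'.mem (k + 1) (by omega) hkl) h.notMem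
  · exact hkl
  · exact absurd (by exact_mod_cast h.mem (l + 1) (by omega) hkl) h'.notMem

lemma walk_line {e : ℕ} (he : e ∈ codes) {q m : ℕ} {c : Finset (ℤ × ℤ)} (h : Rep m c)
    (hq : OnBoard 12 10 (pt q)) (ho : occ m (step e q) = true) {q' m' : ℕ}
    (hw : walk e 13 (step e q) m = (q', m')) :
    ∃ k, Line (pt q) (dir e) c k ∧ pt q' = ray (pt q) (dir e) (k + 1) ∧
      Rep m' (c \ (Finset.Icc 1 k).image fun i : ℕ ↦ ray (pt q) (dir e) i) := by
  obtain ⟨h₁, h₂⟩ := pt_step he hq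
  obtain ⟨k, -, hq', hc, hn, -, hr⟩ := walk_spec he 13 h h₂ hw
  have hk := line_short he h.onBoard hc
  have hray (i : ℕ) : ray (pt (step e q)) (dir e) i = ray (pt q) (dir e) ((i + 1 : ℕ) : ℤ) := by
    rw [h₁, ray_ray, add_comm, Nat.cast_add, Nat.cast_one]
  simp only [hray] at hq' hc hr
  refine ⟨k, ⟨?_, fun i hi hik ↦ ?_, ?_⟩, by exact_mod_cast hq', ?_⟩
  · by_contra hk0
    obtain rfl : k = 0 := by omega
    refine hn (by omega) ?_
    rw [hq', ← hray, Nat.cast_zero, ray_zero]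
    exact (h.occ_iff _ h₂).1 ho
  · obtain ⟨i, rfl⟩ := Nat.exists_eq_add_of_le' hi
    exact hc i (by omega)
  · have := hn hk
    rw [hq'] at this
    exact_mod_cast this
  · convert hr using 2
    ext p
    simp only [Finset.mem_image, Finset.mem_range, Finset.mem_Icc]
    constructor
    · rintro ⟨i, ⟨hi, hik⟩, rfl⟩
      obtain ⟨i, rfl⟩ := Nat.exists_eq_add_of_le' hi
      exact ⟨i, by omega, rfl⟩
    · rintro ⟨i, hi, rfl⟩
      exact ⟨i + 1, by omega, rfl⟩

lemma hop_sound {e : ℕ} (he : e ∈ codes) {q m : ℕ} {c : Finset (ℤ × ℤ)} (h : Rep m c)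
    (hq : OnBoard 12 10 (pt q)) {q' m' : ℕ} (hh : hop e q m = some (q', m')) :
    inCols q' = true ∧ ∃ c', Hop 10 (pt q) c (pt q') c' ∧ Rep m' c' := by
  simp only [hop, eager_eq] at hh
  cases ho : occ m (step e q) <;> simp only [ho, cond_false, cond_true, reduceCtorEq] at hh
  rcases hw : walk e 13 (step e q) m with ⟨q₁, m₁⟩
  cases hi : inCols q₁ <;> simp [hw, hi] at hh
  obtain ⟨rfl, rfl⟩ := hh
  obtain ⟨k, hl, hq', hr⟩ := walk_line he h hq ho hw
  have := inCols_iff.1 hi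
  rw [hq'] at this
  exact ⟨hi, _, ⟨dir e, mem_dirs.2 ⟨e, he, rfl⟩, k, hl.pos, hl.mem, hl.notMem, this.1, this.2,
    hq', rfl⟩, hr⟩

lemma hop_complete {q m : ℕ} {c : Finset (ℤ × ℤ)} (h : Rep m c) (hq : OnBoard 12 10 (pt q))
    {b' : ℤ × ℤ} {c' : Finset (ℤ × ℤ)} (hh : Hop 10 (pt q) c b' c') :
    ∃ e ∈ codes, ∃ q' m', hop e q m = some (q', m') ∧ inCols q' = true ∧ b' = pt q' ∧
      Rep m' c' := by
  obtain ⟨d, hd, k, hk, hm, hn, h1, h10, rfl, rfl⟩ := hh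
  obtain ⟨e, he, rfl⟩ := mem_dirs.1 hd
  obtain ⟨hs, h64⟩ := pt_step he hq
  have ho : occ m (step e q) = true := by
    rw [h.occ_iff _ h64, hs]
    exact_mod_cast hm 1 le_rfl hk
  rcases hw : walk e 13 (step e q) m with ⟨q', m'⟩
  obtain ⟨l, hl, hq', hr⟩ := walk_line he h hq ho hw
  obtain rfl := hl.unique ⟨hk, hm, hn⟩
  have hi : inCols q' = true := inCols_iff.2 (hq' ▸ ⟨h1, h10⟩)
  exact ⟨e, he, q', m', by simp [hop, eager_eq, ho, hw, hi], hi, hq'.symm, hr⟩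

lemma allJumps_complete {P : ℕ → ℕ → Bool} (f : ℕ) {q m : ℕ} {c : Finset (ℤ × ℤ)} (h : Rep m c)
    (hq : OnBoard 12 10 (pt q)) (hP : allJumps P f q m = true) {b' : ℤ × ℤ}
    {c' : Finset (ℤ × ℤ)} (hj : Jump 12 10 (pt q) c b' c') :
    ∃ q' m', P q' m' = true ∧ inCols q' = true ∧ b' = pt q' ∧ Rep m' c' := by
  induction f generalizing q m c with
  | zero => exact absurd hP Bool.false_ne_true
  | succ f ih =>
    replace hP := List.all_eq_true.1 (show codes.all _ = true from hP)
    cases hj with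
    | single hh =>
      obtain ⟨e, he, q', m', ho, hi, hb, hr⟩ := hop_complete h hq hh
      have := hP e he
      simp only [ho, Bool.and_eq_true] at this
      exact ⟨q', m', this.1, hi, hb, hr⟩
    | cons hh h1 h12 hj =>
      obtain ⟨e, he, q', m', ho, hi, rfl, hr⟩ := hop_complete h hq hh
      have := hP e he
      have hrow := inRows_iff.2 ⟨h1, h12⟩
      have hcol := inCols_iff.1 hi
      simp only [ho, hrow, Bool.and_eq_true, Bool.not_true, Bool.false_or] at this
      exact ih hr ⟨hcol.1, hcol.2, h1, h12⟩ this.2 hj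

/-- A jump of player `a` that wins, and still does after a chap is placed outside of `l`. -/
def Threat (a : Player) (l : List ℕ) (b : ℤ × ℤ) (c : Finset (ℤ × ℤ)) : Prop :=
  ∃ q' c', won a q' = true ∧ Jump 12 10 b c (pt q') c' ∧
    ∀ p ∉ c, p ∉ l.map pt → Jump 12 10 b (insert p c) (pt q') (insert p c')

lemma hop_insert {n : ℤ} {b b' p : ℤ × ℤ} {c c' : Finset (ℤ × ℤ)} (h : Hop n b c b' c')
    (hp : p ∉ c) (hb : p ≠ b') : Hop n b (insert p c) b' (insert p c') := by
  obtain ⟨d, hd, k, hk, hm, hn, h1, h10, rfl, rfl⟩ := h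
  refine ⟨d, hd, k, hk, fun i hi hik ↦ Finset.mem_insert_of_mem (hm i hi hik), ?_, h1, h10, rfl, ?_⟩
  · simp [hn, hb.symm]
  · refine (Finset.insert_sdiff_of_notMem _ fun hpi ↦ ?_).symm
    obtain ⟨i, hi, rfl⟩ := Finset.mem_image.1 hpi
    obtain ⟨h₁, h₂⟩ := Finset.mem_Icc.1 hi
    exact hp (hm i h₁ h₂)

lemma hop_subset {n : ℤ} {b b' : ℤ × ℤ} {c c' : Finset (ℤ × ℤ)} (h : Hop n b c b' c') :
    c' ⊆ c := by
  obtain ⟨-, -, -, -, -, -, -, -, -, rfl⟩ := h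
  exact Finset.sdiff_subset

lemma threat_sound {a : Player} (f : ℕ) {q m : ℕ} {c : Finset (ℤ × ℤ)} (h : Rep m c)
    (hq : OnBoard 12 10 (pt q)) {l : List ℕ} (ht : threat a f q m = some l) :
    Threat a l (pt q) c := by
  induction f generalizing q m c l with
  | zero => cases ht
  | succ f ih =>
    obtain ⟨e, he, hl⟩ := List.exists_of_findSome?_eq_some (show codes.findSome? _ = some l from ht)
    rcases ho : hop e q m with _ | ⟨q', m'⟩
    · simp [ho] at hl
    obtain ⟨hi, c', hh, hr⟩ := hop_sound he h hq ho
    simp only [ho] at hl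
    cases hw : won a q'
    · cases hrow : inRows q'
      · simp [hw, hrow] at hl
      simp only [hw, hrow, cond_false, cond_true, Option.map_eq_some_iff] at hl
      obtain ⟨l, hl, rfl⟩ := hl
      obtain ⟨h1, h12⟩ := inRows_iff.1 hrow
      obtain ⟨hc1, hc10⟩ := inCols_iff.1 hi
      obtain ⟨q'', c'', hw, hj, hp⟩ := ih hr ⟨hc1, hc10, h1, h12⟩ hl
      refine ⟨q'', c'', hw, .cons hh h1 h12 hj, fun p hpc hpl ↦ ?_⟩
      rw [List.map_cons, List.mem_cons, not_or] at hpl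
      exact .cons (hop_insert hh hpc hpl.1) h1 h12 (hp p (fun hpc' ↦ hpc (hop_subset hh hpc')) hpl.2)
    · simp only [hw, cond_true, Option.some.injEq] at hl
      subst hl
      refine ⟨q', c', hw, .single hh, fun p hpc hpl ↦ .single (hop_insert hh hpc ?_)⟩
      simpa using hpl

/-- Player `p` can force a win within `k` turns. -/
inductive WinsIn (m n : ℤ) (p : Player) : ℕ → PState → Prop
  | won {k s} : winner m s = some p → WinsIn m n p k s
  | move {k s t} : winner m s = none → s.turn = p → MoveRel m n s t → WinsIn m n p k t →
      WinsIn m n p (k + 1) s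
  | wait {k s} : winner m s = none → s.turn ≠ p → (∃ t, MoveRel m n s t) →
      (∀ t, MoveRel m n s t → WinsIn m n p k t) → WinsIn m n p (k + 1) s

section Strategies

variable {m n : ℤ} {p : Player}

lemma WinsIn.mono {k l : ℕ} {s : PState} (h : WinsIn m n p k s) (hkl : k ≤ l) :
    WinsIn m n p l s := by
  induction h generalizing l with
  | won h => exact .won h
  | move h₁ h₂ h₃ _ ih =>
    obtain ⟨l, rfl⟩ := Nat.exists_eq_add_of_le' (Nat.one_le_of_lt hkl)
    exact .move h₁ h₂ h₃ (ih (by omega))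
  | wait h₁ h₂ h₃ _ ih =>
    obtain ⟨l, rfl⟩ := Nat.exists_eq_add_of_le' (Nat.one_le_of_lt hkl)
    exact .wait h₁ h₂ h₃ fun t ht ↦ ih t ht (by omega)

open Classical in
/-- A legal strategy that decreases the number of turns to a win whenever a win can be forced. -/
lemma exists_strategy (m n : ℤ) (p : Player) :
    ∃ σ, LegalStrategy m n p σ ∧
      ∀ s t k, MoveRel m n s t → WinsIn m n p k t → WinsIn m n p k (σ s) := by
  have (s : PState) : ∃ t, ((∃ u, MoveRel m n s u) → MoveRel m n s t) ∧
      ∀ u k, MoveRel m n s u → WinsIn m n p k u → WinsIn m n p k t := by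
    by_cases h : ∃ k u, MoveRel m n s u ∧ WinsIn m n p k u
    · obtain ⟨t, h₁, h₂⟩ := Nat.find_spec h
      exact ⟨t, fun _ ↦ h₁, fun u k hu hk ↦ h₂.mono (Nat.find_min' h ⟨u, hu, hk⟩)⟩
    · push Not at h
      by_cases h' : ∃ u, MoveRel m n s u
      · exact ⟨h'.choose, fun _ ↦ h'.choose_spec, fun u k hu hk ↦ absurd hk (h k u hu)⟩
      · exact ⟨s, fun hu ↦ absurd hu h', fun u k hu _ ↦ absurd ⟨u, hu⟩ h'⟩
  choose σ h₁ h₂ using this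
  exact ⟨σ, fun s _ _ h ↦ h₁ s h, fun s t k h h' ↦ h₂ s t k h h'⟩

theorem WinsIn.winsFrom {k : ℕ} {s : PState} (h : WinsIn m n p k s) : WinsFrom m n p s := by
  obtain ⟨σ, hσ, hdec⟩ := exists_strategy m n p
  refine ⟨σ, hσ, fun f hf h₀ hfol ↦ ?_⟩
  suffices ∀ k j, WinsIn m n p k (f j) → ∃ i, winner m (f i) = some p from this k 0 (h₀ ▸ h)
  intro k
  induction k with
  | zero => intro j hj; cases hj with | won h => exact ⟨j, h⟩
  | succ k ih =>
    intro j hj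
    cases hj with
    | won h => exact ⟨j, h⟩
    | move h₁ h₂ h₃ h₄ =>
      refine ih (j + 1) ?_
      rw [hfol j h₂ h₁ ⟨_, h₃⟩]
      exact hdec _ _ _ h₃ h₄
    | wait h₁ _ h₃ h₄ =>
      rcases hf j with ⟨-, -, hm⟩ | ⟨hm | hm, -⟩
      exacts [ih (j + 1) (h₄ _ hm), absurd h₁ hm, absurd h₃ hm]

/-- Player `p` cannot win from a set of positions in which the opponent can stay. -/
theorem not_winsFrom (S : Set PState) (hS : ∀ s ∈ S, winner m s ≠ some p)
    (hmove : ∀ s ∈ S, winner m s = none → s.turn = p → ∀ t, MoveRel m n s t → t ∈ S)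
    (hreply : ∀ s ∈ S, winner m s = none → s.turn ≠ p → ∃ t ∈ S, MoveRel m n s t)
    {s₀ : PState} (hs₀ : s₀ ∈ S) : ¬ WinsFrom m n p s₀ := by
  rintro ⟨σ, hσ, hwin⟩
  have (s : PState) : ∃ t, (s ∈ S → t ∈ S) ∧
      ((winner m s = none ∧ (∃ t, MoveRel m n s t) ∧ MoveRel m n s t) ∨
        ((winner m s ≠ none ∨ ¬ ∃ t, MoveRel m n s t) ∧ t = s)) ∧
      (s.turn = p → winner m s = none → (∃ t, MoveRel m n s t) → t = σ s) := by
    by_cases hw : winner m s = none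
    · by_cases ht : ∃ t, MoveRel m n s t
      · by_cases hp : s.turn = p
        · have := hσ s hp hw ht
          exact ⟨σ s, fun hs ↦ hmove s hs hw hp _ this, .inl ⟨hw, ht, this⟩, fun _ _ _ ↦ rfl⟩
        · by_cases hs : s ∈ S
          · obtain ⟨t, htS, hst⟩ := hreply s hs hw hp
            exact ⟨t, fun _ ↦ htS, .inl ⟨hw, ht, hst⟩, fun h ↦ absurd h hp⟩
          · obtain ⟨t, hst⟩ := ht
            exact ⟨t, fun h ↦ absurd h hs, .inl ⟨hw, ⟨t, hst⟩, hst⟩, fun h ↦ absurd h hp⟩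
      · exact ⟨s, id, .inr ⟨.inr ht, rfl⟩, fun _ _ h ↦ absurd h ht⟩
    · exact ⟨s, id, .inr ⟨.inl hw, rfl⟩, fun _ h ↦ absurd h hw⟩
  choose g hg₁ hg₂ hg₃ using this
  have hstep (k : ℕ) : g^[k + 1] s₀ = g (g^[k] s₀) := Function.iterate_succ_apply' ..
  have hmem (k : ℕ) : g^[k] s₀ ∈ S := by
    induction k with
    | zero => exact hs₀
    | succ k ih => exact hstep k ▸ hg₁ _ ih
  obtain ⟨k, hk⟩ := hwin (fun k ↦ g^[k] s₀) (fun k ↦ by simpa only [hstep] using hg₂ _) rfl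
    (fun k ↦ by simpa only [hstep] using hg₃ _)
  exact hS _ (hmem k) hk

end Strategies

/-- The position `s` is described by the ball's square `q` and the mask `m`. -/
structure IsAt (s : PState) (q m : ℕ) : Prop where
  ball : s.ball = pt q
  rep : Rep m s.chaps
  onBoard : OnBoard 12 10 (pt q)

lemma vacant_iff {s : PState} {q m x : ℕ} (hs : IsAt s q m) :
    vacant q m x = true ↔ OnBoard 12 10 (pt x) ∧ pt x ∉ s.chaps ∧ pt x ≠ s.ball := by
  have hx : Nat.beq x q = true ↔ pt x = s.ball := by
    rw [Nat.beq_eq, hs.ball]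
    exact ⟨fun h ↦ h ▸ rfl, pt_injective⟩
  have ho (h : OnBoard 12 10 (pt x)) := hs.rep.occ_iff x (onBoard_pt h)
  simp only [vacant, Bool.and_eq_true, inCols_iff, inRows_iff, Bool.not_eq_true', ne_eq, ← hx,
    Bool.not_eq_true, OnBoard, and_assoc] at *
  constructor
  · rintro ⟨h1, h10, h1', h12, h, h'⟩
    simpa [h1, h10, h1', h12, h, h'] using ho
  · rintro ⟨h1, h10, h1', h12, h, h'⟩
    simpa [h1, h10, h1', h12, h, h'] using ho

/-- The position after placing a chap on the square `x`. -/
def place (s : PState) (x : ℕ) : PState := ⟨s.ball, insert (pt x) s.chaps, !s.turn⟩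

lemma IsAt.place {s : PState} {q m x : ℕ} (hs : IsAt s q m) (hx : vacant q m x = true) :
    MoveRel 12 10 s (place s x) ∧ IsAt (place s x) q (toggle m x) := by
  obtain ⟨h₁, h₂, h₃⟩ := (vacant_iff hs).1 hx
  exact ⟨⟨rfl, .inl ⟨pt x, h₁, h₂, h₃, rfl, rfl⟩⟩, hs.ball, hs.rep.insert h₂ h₁, hs.onBoard⟩

lemma eq_place_or_jump {s t : PState} {q m : ℕ} (hs : IsAt s q m) (h : MoveRel 12 10 s t) :
    (∃ x ∈ squares, vacant q m x = true ∧ t = place s x) ∨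
      Jump 12 10 (pt q) s.chaps t.ball t.chaps := by
  obtain ⟨ht, ⟨p, hp, hpc, hpb, hb, hc⟩ | hj⟩ := h
  · obtain ⟨x, hx, rfl⟩ := exists_pt hp
    refine .inl ⟨x, hx, (vacant_iff hs).2 ⟨hp, hpc, hpb⟩, ?_⟩
    obtain ⟨b, c, t⟩ := t
    simp_all [Phutball.place]
  · exact .inr (hs.ball ▸ hj)

lemma threat_winsIn {a : Player} {s : PState} {q m : ℕ} (hs : IsAt s q m) (hw : winner 12 s = none)
    (hturn : s.turn = a) (h : (threat a 30 q m).isSome = true) (k : ℕ) :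
    WinsIn 12 10 a (k + 1) s := by
  obtain ⟨l, hl⟩ := Option.isSome_iff_exists.1 h
  obtain ⟨q', c', hq', hj, -⟩ := threat_sound 30 hs.rep hs.onBoard hl
  exact .move hw hturn (t := ⟨pt q', c', !s.turn⟩) ⟨rfl, .inr (hs.ball ▸ hj)⟩
    (.won ((winner_eq_some_iff rfl a).2 hq'))

lemma isAt_jump {a : Player} {s : PState} {q m : ℕ} (hq : s.ball = pt q) (hm : Rep m s.chaps)
    (hcol : inCols q = true) (h₁ : won a q = false) (h₂ : won (!a) q = false) :
    winner 12 s = none ∧ IsAt s q m := by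
  have hw := winner_eq_none hq a h₁ h₂
  refine ⟨hw, hq, hm, ?_⟩
  have := inCols_iff.1 hcol
  simp only [winner, hq] at hw
  refine ⟨this.1, this.2, ?_, ?_⟩ <;> split_ifs at hw <;> omega

lemma defends_sound {a : Player} {next : ℕ → ℕ → Bool} {k : ℕ} (hk : 1 ≤ k)
    (hnext : ∀ s q m, IsAt s q m → winner 12 s = none → s.turn = a → next q m = true →
      WinsIn 12 10 a k s)
    {s : PState} {q m : ℕ} (hs : IsAt s q m) (hw : winner 12 s = none) (hturn : s.turn = !a)
    (h : defends a next q m = true) : WinsIn 12 10 a (k + 1) s := by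
  simp only [defends, Bool.and_eq_true, List.any_eq_true] at h
  obtain ⟨⟨⟨x, -, hx⟩, hj⟩, hp⟩ := h
  refine .wait hw (by simp [hturn]) ⟨_, (hs.place hx).1⟩ fun t ht ↦ ?_
  have hta : t.turn = a := by simp [ht.1, hturn]
  rcases eq_place_or_jump hs ht with ⟨x, hxs, hx, rfl⟩ | ht
  · have hxp := (hs.place hx).2
    rw [allPlacements, List.all_eq_true] at hp
    rcases hl : threat a 30 q m with _ | l
    · have := hp x (by simpa [hl] using hxs)
      exact hnext _ _ _ hxp hw hta (by simpa [hx, eager_eq] using this)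
    · by_cases hxl : x ∈ l
      · have := hp x (by simpa [hl] using hxl)
        exact hnext _ _ _ hxp hw hta (by simpa [hx, eager_eq] using this)
      · obtain ⟨q', c', hq', -, hj⟩ := threat_sound 30 hs.rep hs.onBoard hl
        have hxl' : pt x ∉ l.map pt := fun hx' ↦ by
          obtain ⟨y, hy, hyx⟩ := List.mem_map.1 hx'
          exact hxl (pt_injective hyx ▸ hy)
        refine WinsIn.mono (.move hw hta (t := ⟨pt q', insert (pt x) c', !a⟩) ⟨by simp [hta], .inr ?_⟩
          (.won ((winner_eq_some_iff rfl a).2 hq'))) hk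
        exact hxp.ball ▸ hj _ ((vacant_iff hs).1 hx).2.1 hxl'
  · obtain ⟨q', m', hP, hcol, hb, hr⟩ := allJumps_complete 30 hs.rep hs.onBoard hj ht
    cases hwa : won a q'
    · simp only [hwa, Bool.false_or, Bool.and_eq_true, Bool.not_eq_true'] at hP
      obtain ⟨hw', ht'⟩ := isAt_jump hb hr hcol hwa hP.1
      exact hnext _ _ _ ht' hw' hta hP.2
    · exact .won ((winner_eq_some_iff hb a).2 hwa)

lemma attacks_sound {a : Player} (hs : List (List ℕ)) {s : PState} {q m : ℕ} (hat : IsAt s q m)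
    (hw : winner 12 s = none) (hturn : s.turn = a) (h : attacks a hs q m = true) :
    WinsIn 12 10 a (2 * hs.length + 1) s := by
  induction hs generalizing s q m with
  | nil => exact threat_winsIn hat hw hturn h _
  | cons l hs ih =>
    simp only [attacks, Bool.or_eq_true, List.any_eq_true, Bool.and_eq_true, eager_eq] at h
    rcases h with h | ⟨x, -, hx, hd⟩
    · exact threat_winsIn hat hw hturn h _
    · obtain ⟨hm, hp⟩ := hat.place hx
      exact .move hw hturn hm (defends_sound (by omega) (fun s q m hs hw hturn h ↦ ih hs hw hturn h)
        hp hw (by simp [place, hturn]) hd)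

lemma allLose_sound {a : Player} {hints : ℕ → List (List ℕ)} {q₀ m₀ q m : ℕ} {s t : PState}
    (hs : IsAt s q m) (hw : winner 12 s = none) (hturn : s.turn = !a)
    (h : allLose a hints q₀ m₀ q m = true) (ht : MoveRel 12 10 s t) :
    (t.ball = pt q₀ ∧ Rep m₀ t.chaps) ∨ ∃ k, WinsIn 12 10 a k t := by
  simp only [allLose, Bool.and_eq_true] at h
  have hta : t.turn = a := by simp [ht.1, hturn]
  rcases eq_place_or_jump hs ht with ⟨x, hxs, hx, rfl⟩ | ht
  · have hxp := (hs.place hx).2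
    have := h.2
    rw [allPlacements, List.all_eq_true] at this
    have := this x hxs
    simp only [hx, eager_eq, Bool.not_true, Bool.false_or, Bool.or_eq_true, Bool.and_eq_true,
      Nat.beq_eq] at this
    rcases this with ⟨rfl, rfl⟩ | this
    · exact .inl ⟨hxp.ball, hxp.rep⟩
    · exact .inr ⟨_, attacks_sound _ hxp hw hta this⟩
  · obtain ⟨q', m', hP, hcol, hb, hr⟩ := allJumps_complete 30 hs.rep hs.onBoard h.1 ht
    simp only [Bool.or_eq_true, Bool.and_eq_true, Nat.beq_eq, Bool.not_eq_true'] at hP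
    rcases hP with (⟨rfl, rfl⟩ | hP) | hP
    · exact .inl ⟨hb, hr⟩
    · exact .inr ⟨0, .won ((winner_eq_some_iff hb a).2 hP)⟩
    · cases hwa : won a q'
      · obtain ⟨hw', ht'⟩ := isAt_jump hb hr hcol hwa hP.1
        exact .inr ⟨_, attacks_sound _ ht' hw' hta hP.2⟩
      · exact .inr ⟨0, .won ((winner_eq_some_iff hb a).2 hwa)⟩

/-- Every move from the `i`-th position of the cycle to a position outside of the cycle loses
against `a`. -/
def deviationsLose (a : Player) (i : ℕ) : Bool :=
  eager (cycleBall i) fun q => eager (cycleMask i) fun m =>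
  eager (cycleBall ((i + 1) % 18)) fun q₀ => eager (cycleMask ((i + 1) % 18)) fun m₀ =>
    allLose a (cycleHints i) q₀ m₀ q m

/-- A placement or a single hop leads from `(q, m)` to `(q', m')`. -/
def leadsTo (q m q' m' : ℕ) : Bool :=
  (q' == q && squares.any fun x => vacant q m x && m' == toggle m x) ||
    codes.any fun e => hop e q m == some (q', m')

set_option maxRecDepth 100000 in
lemma betty_deviationsLose :
    [1, 3, 5, 7, 9, 11, 13, 15, 17].all (deviationsLose true) = true := by
  decide +kernel

set_option maxRecDepth 100000 in
lemma alfred_deviationsLose : deviationsLose false 6 = true := by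
  decide +kernel

set_option maxRecDepth 100000 in
lemma cycle_leadsTo : [0, 2, 4, 6, 8, 10, 12, 14, 16].all (fun i =>
    leadsTo (cycleBall i) (cycleMask i) (cycleBall (i + 1)) (cycleMask (i + 1))) = true := by
  decide +kernel

/-- The `i`-th position of the drawing cycle. -/
structure IsCycle (i : ℕ) (s : PState) : Prop where
  ball : s.ball = pt (cycleBall i)
  rep : Rep (cycleMask i) s.chaps
  turn : s.turn = decide (i % 2 = 0)

lemma cycleBall_eq (i : ℕ) : cycleBall i = 97 ∨ cycleBall i = 250 := by
  rw [cycleBall]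
  cases Nat.ble i 8 <;> simp

lemma IsCycle.isAt {i : ℕ} {s : PState} (h : IsCycle i s) :
    winner 12 s = none ∧ IsAt s (cycleBall i) (cycleMask i) := by
  rcases cycleBall_eq i with hb | hb <;>
    exact isAt_jump (a := true) h.ball h.rep (by rw [hb]; rfl) (by rw [hb]; rfl) (by rw [hb]; rfl)

lemma leadsTo_sound {s : PState} {q m q' m' : ℕ} (hs : IsAt s q m)
    (h : leadsTo q m q' m' = true) :
    ∃ t, MoveRel 12 10 s t ∧ t.ball = pt q' ∧ Rep m' t.chaps := by
  simp only [leadsTo, Bool.or_eq_true, Bool.and_eq_true, List.any_eq_true, beq_iff_eq] at h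
  rcases h with ⟨rfl, x, -, hx, rfl⟩ | ⟨e, he, h⟩
  · exact ⟨_, (hs.place hx).1, (hs.place hx).2.ball, (hs.place hx).2.rep⟩
  · obtain ⟨-, c', hh, hr⟩ := hop_sound he hs.rep hs.onBoard h
    exact ⟨⟨pt q', c', !s.turn⟩, ⟨rfl, .inr (.single (hs.ball ▸ hh))⟩, rfl, hr⟩

lemma IsCycle.deviate {i : ℕ} {a : Player} {s t : PState} (h : IsCycle i s)
    (hdev : deviationsLose a i = true) (hturn : s.turn = !a) (ht : MoveRel 12 10 s t) :
    IsCycle ((i + 1) % 18) t ∨ ∃ k, WinsIn 12 10 a k t := by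
  simp only [deviationsLose, eager_eq] at hdev
  refine (allLose_sound h.isAt.2 h.isAt.1 hturn hdev ht).imp_left fun h' ↦ ⟨h'.1, h'.2, ?_⟩
  rw [ht.1, h.turn, ← decide_not, decide_eq_decide]
  omega

/-- Positions in which Alfred avoids losing: he wins, or keeps to the cycle. -/
def nonlosing : Set PState := {s | (∃ i < 18, IsCycle i s) ∨ ∃ k, WinsIn 12 10 true k s}

lemma IsCycle.not_winsFrom {i : ℕ} {s : PState} (hi : i < 18) (h : IsCycle i s) :
    ¬ WinsFrom 12 10 false s := by
  refine Phutball.not_winsFrom nonlosing ?_ ?_ ?_ (.inl ⟨i, hi, h⟩)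
  · rintro s (⟨i, -, h⟩ | ⟨k, h⟩)
    · simp [h.isAt.1]
    · cases h <;> simp_all
  · rintro s (⟨i, hi, h⟩ | ⟨k, h⟩) hw hs t ht
    · have hodd : i % 2 ≠ 0 := by simpa [h.turn] using hs
      refine (h.deviate (a := true) (List.all_eq_true.1 betty_deviationsLose i ?_) hs ht).imp_left
        fun h' ↦ ⟨_, Nat.mod_lt _ (by omega), h'⟩
      simp only [List.mem_cons, List.not_mem_nil, or_false]
      omega
    · cases h with
      | won h => simp [h] at hw
      | move _ h => simp [h] at hs
      | wait _ _ _ h => exact .inr ⟨_, h t ht⟩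
  · rintro s (⟨i, hi, h⟩ | ⟨k, h⟩) hw hs
    · have heven : i % 2 = 0 := by simpa [h.turn] using hs
      have hl := List.all_eq_true.1 cycle_leadsTo i (by
        simp only [List.mem_cons, List.not_mem_nil, or_false]
        omega)
      obtain ⟨t, ht, hb, hr⟩ := leadsTo_sound h.isAt.2 hl
      refine ⟨t, .inl ⟨i + 1, by omega, hb, hr, ?_⟩, ht⟩
      rw [ht.1, h.turn, ← decide_not, decide_eq_decide]
      omega
    · cases h with
      | won h => simp [h] at hw
      | move _ _ hm h => exact ⟨_, .inr ⟨_, h⟩, hm⟩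
      | wait _ h => exact absurd (by simpa using hs) h

lemma isCycle_P6 : IsCycle 6 P6 := by
  refine ⟨by decide, ⟨?_, fun q hq ↦ ?_⟩, rfl⟩
  · have : ∀ p ∈ P6.chaps, 1 ≤ p.1 ∧ p.1 ≤ 10 ∧ 1 ≤ p.2 ∧ p.2 ≤ 12 := by decide +kernel
    exact this
  · by_cases hq' : q < 288
    · have : ∀ r < 288, 64 ≤ r → (occ (cycleMask 6) r = true ↔ pt r ∈ P6.chaps) := by
        decide +kernel
      exact this q hq' hq
    · have h₁ : occ (cycleMask 6) q = false := by
        rw [occ_eq_testBit]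
        refine Nat.testBit_lt_two_pow (lt_of_lt_of_le ?_ (Nat.pow_le_pow_right two_pos
          (not_lt.1 hq')))
        decide +kernel
      have h₂ : ∀ p ∈ P6.chaps, p.2 ≤ 12 := by decide +kernel
      refine iff_of_false (by simp [h₁]) fun h ↦ ?_
      have := h₂ _ h
      simp only [pt] at this
      omega

end Phutball

/-- From `P6`, placing a chap at h9 is Alfred's unique non-losing move:
it is a legal move; after it, Betty has no winning strategy from the resulting
position; and every other legal move of Alfred from `P6` leads to a position
from which Betty has a winning strategy. -/
theorem P6_unique_nonlosing :
    MoveRel 12 10 P6 P6_h9 ∧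
    ¬ WinsFrom 12 10 false P6_h9 ∧
    ∀ t, MoveRel 12 10 P6 t → t ≠ P6_h9 → WinsFrom 12 10 false t := by
  have h₆ := Phutball.isCycle_P6
  obtain ⟨hmove, -, hrep, -⟩ :=
    h₆.isAt.2.place (x := 216) (by decide +kernel)
  have h₇ : Phutball.IsCycle 7 P6_h9 := ⟨h₆.ball, hrep, rfl⟩
  refine ⟨hmove, h₇.not_winsFrom (by norm_num), fun t ht hne ↦ ?_⟩
  rcases h₆.deviate Phutball.alfred_deviationsLose rfl ht with h | ⟨k, h⟩
  · refine absurd ?_ hne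
    have hball := h.ball.trans h₇.ball.symm
    have hchaps := h.rep.unique h₇.rep
    have hturn := h.turn.trans h₇.turn.symm
    cases t
    simp_all
  · exact h.winsFrom
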